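/- arXiv:1707.06091 — 2 statements merged into one kernel-verified Lean document; each statement's English description precedes it below -/
import Mathlib

section
/- Let p be a prime and n ≥ 1. For g, h ∈ Sp_{2n}(ℚ_p), one has |Pl(g)|_p = |Pl(h)|_p if and only if there exist q ∈ [P,P](ℚ_p) and k ∈ Sp_{2n}(ℤ_p) such that g = q·h·k. (Proposition 2.3, non-Archimedean case: the map X(ℚ_p)/Sp_{2n}(ℤ_p) → ℝ_{>0}, [P,P](ℚ_p)gSp_{2n}(ℤ_p) ↦ |Pl(g)|_p, is a well-defined injection.) -/
open Matrix

/-- The standard symplectic structure matrix `J = (0, Iₙ; -Iₙ, 0)`. -/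
def Jmat (F : Type*) [Field F] (n : ℕ) : Matrix (Fin n ⊕ Fin n) (Fin n ⊕ Fin n) F :=
  Matrix.fromBlocks 0 1 (-1) 0

/-- `Sp_{2n}(F) = {g : g * J⁻¹ * gᵀ * J = 1}`. -/
def Sp (F : Type*) [Field F] (n : ℕ) : Set (Matrix (Fin n ⊕ Fin n) (Fin n ⊕ Fin n) F) :=
  {g | g * (Jmat F n)⁻¹ * gᵀ * Jmat F n = 1}

/-- `[P,P](F)`: elements of `Sp_{2n}(F)` of block form `(A, B; 0, (Aᵀ)⁻¹)` with `det A = 1`. -/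
def SiegelPP (F : Type*) [Field F] (n : ℕ) :
    Set (Matrix (Fin n ⊕ Fin n) (Fin n ⊕ Fin n) F) :=
  {g | g ∈ Sp F n ∧ ∃ A B : Matrix (Fin n) (Fin n) F,
    g = Matrix.fromBlocks A B 0 Aᵀ⁻¹ ∧ A.det = 1}

/-- The Plücker map: the wedge product (in the `n`-th exterior power of the space of row
vectors `F^{2n}`) of the last `n` rows of `g`, from top to bottom. -/
noncomputable def Pl (F : Type*) [Field F] (n : ℕ)
    (g : Matrix (Fin n ⊕ Fin n) (Fin n ⊕ Fin n) F) :
    ExteriorAlgebra F ((Fin n ⊕ Fin n) → F) :=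
  ExteriorAlgebra.ιMulti F n (fun i => g (Sum.inr i))

/-- The `j`-th element (in increasing order, with the standard identification
`Fin n ⊕ Fin n ≅ Fin 2n`) of a subset `s` of the index set of size `n`. -/
noncomputable def colsOf (n : ℕ) (s : Finset (Fin n ⊕ Fin n)) (hs : s.card = n) :
    Fin n → Fin n ⊕ Fin n := fun j =>
  finSumFinEquiv.symm
    (((s.image finSumFinEquiv).orderIsoOfFin
      (by rw [Finset.card_image_of_injective _ finSumFinEquiv.injective, hs]) j : Fin (n + n)))

/-- The coordinate functional on `⋀ⁿ F^{2n}` dual to the standard basis vector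
`e_{α₁} ∧ ⋯ ∧ e_{αₙ}` where `s = {α₁ < ⋯ < αₙ}`. -/
noncomputable def detCoord (F : Type*) [Field F] (n : ℕ) (s : Finset (Fin n ⊕ Fin n))
    (hs : s.card = n) : ExteriorAlgebra F ((Fin n ⊕ Fin n) → F) →ₗ[F] F :=
  ExteriorAlgebra.liftAlternating fun i =>
    if h : i = n then
      ((Matrix.detRowAlternating).compLinearMap
        (LinearMap.funLeft F F (colsOf n s hs))).domDomCongr (finCongr h.symm)
    else 0

/-- The norm `|x|_p = maxₐ |xₐ|_p` of an element of `⋀ⁿ ℚ_p^{2n}`. -/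
noncomputable def padicWedgeNorm (p : ℕ) [Fact p.Prime] (n : ℕ)
    (x : ExteriorAlgebra ℚ_[p] ((Fin n ⊕ Fin n) → ℚ_[p])) : ℝ :=
  ⨆ s : {s : Finset (Fin n ⊕ Fin n) // s.card = n}, ‖detCoord ℚ_[p] n s.1 s.2 x‖

open scoped symmDiff

section Field

variable {F : Type*} [Field F] {n : ℕ}

theorem mem_Sp_iff {g : Matrix (Fin n ⊕ Fin n) (Fin n ⊕ Fin n) F} :
    g ∈ Sp F n ↔ g ∈ symplecticGroup (Fin n) F := by
  have hJ : Jmat F n = -J (Fin n) F := by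
    simp [Jmat, J, fromBlocks_neg]
  have hJ' : (Jmat F n)⁻¹ = J (Fin n) F := by
    rw [hJ]
    exact inv_eq_left_inv (by rw [mul_neg, J_squared, neg_neg])
  rw [SymplecticGroup.mem_iff, Sp, Set.mem_ofPred_eq, hJ', hJ]
  constructor
  · intro h
    have h2 := congrArg (· * J (Fin n) F) h
    simpa [Matrix.mul_assoc, J_squared] using h2
  · intro h
    rw [h, mul_neg, J_squared, neg_neg]

theorem fromBlocks_mem_symplecticGroup_iff {A B C D : Matrix (Fin n) (Fin n) F} :
    fromBlocks A B C D ∈ symplecticGroup (Fin n) F ↔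
      A * Bᵀ = B * Aᵀ ∧ C * Dᵀ = D * Cᵀ ∧ A * Dᵀ - B * Cᵀ = 1 := by
  rw [SymplecticGroup.mem_iff, J, fromBlocks_multiply, fromBlocks_transpose, fromBlocks_multiply,
    fromBlocks_inj]
  simp only [Matrix.mul_zero, Matrix.mul_one, zero_add, Matrix.mul_neg, add_zero,
    Matrix.neg_mul]
  constructor
  · rintro ⟨h1, h2, -, h4⟩
    refine ⟨(add_neg_eq_zero.mp h1).symm, (add_neg_eq_zero.mp h4).symm, ?_⟩
    rw [← neg_inj, ← h2]
    abel
  · rintro ⟨h1, h2, h3⟩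
    refine ⟨by rw [h1]; simp, by rw [← h3]; abel, ?_, by rw [h2]; simp⟩
    have h := congrArg transpose h3
    simp only [transpose_sub, transpose_mul, transpose_transpose, transpose_one] at h
    rw [← h]
    abel

/-- The matrix whose columns in `S` are those of `C` and whose other columns are those of `D`. -/
def mixCols (S : Finset (Fin n)) (C D : Matrix (Fin n) (Fin n) F) : Matrix (Fin n) (Fin n) F :=
  of fun i j => if j ∈ S then C i j else D i j

/-- A Lagrangian subspace has a nonzero Plücker coordinate at some Lagrangian coordinate plane. -/
theorem exists_det_mixCols_ne_zero {C D : Matrix (Fin n) (Fin n) F} (hCD : C * Dᵀ = D * Cᵀ)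
    (hker : ∀ v : Fin n → F, v ᵥ* C = 0 → v ᵥ* D = 0 → v = 0) :
    ∃ S, (mixCols S C D).det ≠ 0 := by
  classical
  obtain ⟨b, -, -, hspan, hb⟩ := exists_linearIndepOn_extension (K := F) (v := C.col)
    (linearIndepOn_empty F C.col) (Set.subset_univ _)
  refine ⟨b.toFinset, fun hdet => ?_⟩
  obtain ⟨v, hv0, hv⟩ := exists_vecMul_eq_zero_iff.mpr hdet
  have hv' (j : Fin n) : v ⬝ᵥ (mixCols b.toFinset C D).col j = 0 := congrFun hv j
  have hvC : v ᵥ* C = 0 := by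
    let φ : (Fin n → F) →ₗ[F] F := dotProductBilin F F v
    have hle : Submodule.span F (C.col '' b) ≤ LinearMap.ker φ := by
      rw [Submodule.span_le]
      rintro _ ⟨j, hj, rfl⟩
      have := hv' j
      simpa [φ, mixCols, col, hj, dotProduct] using this
    ext j
    exact hle (hspan ⟨j, trivial, rfl⟩)
  have hvD (j : Fin n) (hj : j ∉ b) : (v ᵥ* D) j = 0 := by
    have := hv' j
    simpa [mixCols, col, hj, dotProduct, vecMul] using this
  have hCvD : C *ᵥ (v ᵥ* D) = 0 := by
    rw [← mulVec_transpose, mulVec_mulVec, hCD, ← mulVec_mulVec, mulVec_transpose, hvC,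
      mulVec_zero]
  have hb' : LinearIndepOn F C.col (b.toFinset : Set (Fin n)) := by simpa using hb
  have hz := linearIndepOn_finset_iff.mp hb' (v ᵥ* D) (by
    rw [Finset.sum_subset (Finset.subset_univ _) (fun j _ hj => by
      rw [hvD j (by simpa using hj), zero_smul])]
    ext i
    have := congrFun hCvD i
    simpa [mulVec, dotProduct, col, mul_comm, Finset.sum_apply] using this)
  refine hv0 (hker v hvC ?_)
  ext j
  by_cases hj : j ∈ b
  · exact hz j (by simpa using hj)
  · exact hvD j hj

/-- The symplectic matrix exchanging, up to sign, the coordinates `i` and `n + i` for `i ∈ S`. -/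
def exchange (F : Type*) [Field F] {n : ℕ} (S : Finset (Fin n)) :
    Matrix (Fin n ⊕ Fin n) (Fin n ⊕ Fin n) F :=
  fromBlocks (diagonal fun i => if i ∈ S then 0 else 1) (diagonal fun i => if i ∈ S then 1 else 0)
    (-diagonal fun i => if i ∈ S then 1 else 0) (diagonal fun i => if i ∈ S then 0 else 1)

theorem exchange_mem (S : Finset (Fin n)) : exchange F S ∈ symplecticGroup (Fin n) F := by
  rw [exchange, fromBlocks_mem_symplecticGroup_iff]
  refine ⟨?_, ?_, ?_⟩
  · simp [mul_comm]
  · simp [mul_comm]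
  · ext i j
    by_cases hij : i = j
    · subst hij
      by_cases hi : i ∈ S <;> simp [hi]
    · simp [hij]

theorem toBlocks₂₁_mul_exchange (g : Matrix (Fin n ⊕ Fin n) (Fin n ⊕ Fin n) F)
    (S : Finset (Fin n)) :
    (g * exchange F S).toBlocks₂₁ = mixCols S (-g.toBlocks₂₂) g.toBlocks₂₁ := by
  conv_lhs => rw [← fromBlocks_toBlocks g, exchange, fromBlocks_multiply, toBlocks_fromBlocks₂₁]
  ext i j
  by_cases hj : j ∈ S <;> simp [mixCols, hj]

theorem toBlocks₂₂_mul_exchange (g : Matrix (Fin n ⊕ Fin n) (Fin n ⊕ Fin n) F)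
    (S : Finset (Fin n)) :
    (g * exchange F S).toBlocks₂₂ = mixCols S g.toBlocks₂₁ g.toBlocks₂₂ := by
  conv_lhs => rw [← fromBlocks_toBlocks g, exchange, fromBlocks_multiply, toBlocks_fromBlocks₂₂]
  ext i j
  by_cases hj : j ∈ S <;> simp [mixCols, hj]

theorem mixCols_mixCols (S T : Finset (Fin n)) (C D : Matrix (Fin n) (Fin n) F) :
    mixCols T (mixCols S (-D) C) (mixCols S C D) =
      mixCols (S ∆ T) C D * diagonal fun i => if i ∈ S ∩ T then -1 else 1 := by
  ext i j
  by_cases hS : j ∈ S <;> by_cases hT : j ∈ T <;> simp [mixCols, Finset.mem_symmDiff, hS, hT]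

theorem mul_mixCols (S : Finset (Fin n)) (D X Y : Matrix (Fin n) (Fin n) F) :
    D * mixCols S X Y = mixCols S (D * X) (D * Y) := by
  ext i j
  by_cases hS : j ∈ S <;> simp [mixCols, hS, mul_apply]

theorem det_mixCols_one {m : ℕ} (X : Matrix (Fin n) (Fin n) F) (f : Fin m ↪ Fin n) :
    (mixCols (Finset.univ.map f) X 1).det = (X.submatrix f f).det := by
  have h1 : mixCols (Finset.univ.map f) X 1 =
      1 + (X - 1).submatrix id f * (1 : Matrix (Fin n) (Fin n) F).submatrix f id := by
    ext i j
    by_cases hj : j ∈ Finset.univ.map f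
    · obtain ⟨k, -, rfl⟩ := Finset.mem_map.mp hj
      simp [mixCols, mul_apply, one_apply, f.injective.eq_iff]
    · have hj' (k : Fin m) : f k ≠ j := fun h => hj (h ▸ by simp)
      simp [mixCols, mul_apply, one_apply, hj']
  rw [h1, det_one_add_mul_comm]
  congr 1
  rw [← submatrix_mul _ _ f id f Function.bijective_id, one_mul]
  ext i j
  simp [one_apply, f.injective.eq_iff]

theorem detCoord_Pl (g : Matrix (Fin n ⊕ Fin n) (Fin n ⊕ Fin n) F)
    (s : Finset (Fin n ⊕ Fin n)) (hs : s.card = n) :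
    detCoord F n s hs (Pl F n g) = (g.submatrix Sum.inr (colsOf n s hs)).det := by
  rw [detCoord, Pl, ExteriorAlgebra.liftAlternating_apply_ιMulti]
  simp only [dite_true]
  rfl

theorem exists_perm_colsOf (c : Fin n → Fin n ⊕ Fin n) (hc : Function.Injective c) :
    ∃ (s : Finset (Fin n ⊕ Fin n)) (hs : s.card = n) (σ : Equiv.Perm (Fin n)),
      c = colsOf n s hs ∘ σ := by
  have hs : (Finset.univ.image c).card = n := by
    rw [Finset.card_image_of_injective _ hc, Finset.card_univ, Fintype.card_fin]
  refine ⟨Finset.univ.image c, hs, ?_⟩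
  have hex (j : Fin n) : ∃ k, colsOf n _ hs k = c j := by
    have hmem : finSumFinEquiv (c j) ∈ (Finset.univ.image c).image finSumFinEquiv := by simp
    refine ⟨(((Finset.univ.image c).image finSumFinEquiv).orderIsoOfFin
      (by rw [Finset.card_image_of_injective _ finSumFinEquiv.injective, hs])).symm ⟨_, hmem⟩, ?_⟩
    simp [colsOf]
  choose σ hσ using hex
  have hinj : Function.Injective σ := fun i j hij => hc (by rw [← hσ i, ← hσ j, hij])
  exact ⟨Equiv.ofBijective σ (Finite.injective_iff_bijective.mp hinj), funext fun j => (hσ j).symm⟩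

theorem toBlocks_mul_of_toBlocks₂₁_eq_zero {m : Matrix (Fin n ⊕ Fin n) (Fin n ⊕ Fin n) F}
    (hm : m.toBlocks₂₁ = 0) (g : Matrix (Fin n ⊕ Fin n) (Fin n ⊕ Fin n) F) :
    (m * g).toBlocks₂₁ = m.toBlocks₂₂ * g.toBlocks₂₁ ∧
      (m * g).toBlocks₂₂ = m.toBlocks₂₂ * g.toBlocks₂₂ := by
  rw [← fromBlocks_toBlocks m, ← fromBlocks_toBlocks g, fromBlocks_multiply]
  simp [hm]

theorem mul_toBlocks₂₂_transpose_eq_one {m : Matrix (Fin n ⊕ Fin n) (Fin n ⊕ Fin n) F}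
    (hm : m ∈ symplecticGroup (Fin n) F) (hm0 : m.toBlocks₂₁ = 0) :
    m.toBlocks₁₁ * m.toBlocks₂₂ᵀ = 1 := by
  rw [← fromBlocks_toBlocks m, fromBlocks_mem_symplecticGroup_iff, hm0] at hm
  simpa using hm.2.2

theorem toBlocks₂₁_inv {m : Matrix (Fin n ⊕ Fin n) (Fin n ⊕ Fin n) F}
    (hm : m ∈ symplecticGroup (Fin n) F) (hm0 : m.toBlocks₂₁ = 0) : m⁻¹.toBlocks₂₁ = 0 := by
  rw [SymplecticGroup.inv_eq_symplectic_inv m hm, ← fromBlocks_toBlocks m, hm0, J, fromBlocks_neg,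
    fromBlocks_transpose, fromBlocks_multiply, fromBlocks_multiply]
  simp

theorem inv_mem_symplecticGroup {m : Matrix (Fin n ⊕ Fin n) (Fin n ⊕ Fin n) F}
    (hm : m ∈ symplecticGroup (Fin n) F) : m⁻¹ ∈ symplecticGroup (Fin n) F := by
  simpa only [SymplecticGroup.coe_inv'] using (⟨m, hm⟩ : symplecticGroup (Fin n) F)⁻¹.2

theorem mem_SiegelPP_of_det {q : Matrix (Fin n ⊕ Fin n) (Fin n ⊕ Fin n) F}
    (hq : q ∈ symplecticGroup (Fin n) F) (hq0 : q.toBlocks₂₁ = 0) (hdet : q.toBlocks₂₂.det = 1) :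
    q ∈ SiegelPP F n := by
  have h1 := mul_toBlocks₂₂_transpose_eq_one hq hq0
  refine ⟨mem_Sp_iff.mpr hq, q.toBlocks₁₁, q.toBlocks₁₂, ?_, ?_⟩
  · have h2 : q.toBlocks₁₁ᵀ⁻¹ = q.toBlocks₂₂ := inv_eq_left_inv (by
      rw [← transpose_inj, transpose_mul, transpose_transpose, h1, transpose_one])
    rw [h2, ← hq0, fromBlocks_toBlocks]
  · have h2 := congrArg det h1
    rwa [det_mul, det_transpose, hdet, mul_one, det_one] at h2

end Field

section Padic

variable {p : ℕ} [Fact p.Prime] {n : ℕ}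

theorem det_mem_subring {R : Type*} [CommRing R] (S : Subring R) {m : Type*} [Fintype m]
    [DecidableEq m] {M : Matrix m m R} (hM : ∀ i j, M i j ∈ S) : M.det ∈ S := by
  rw [det_apply]
  exact sum_mem fun σ _ => zsmul_mem (prod_mem fun i _ => hM _ _) _

theorem norm_det_le_one {m : Type*} [Fintype m] [DecidableEq m] {M : Matrix m m ℚ_[p]}
    (hM : ∀ i j, ‖M i j‖ ≤ 1) : ‖M.det‖ ≤ 1 :=
  det_mem_subring (PadicInt.subring p) hM

theorem norm_mul_apply_le_one {m : Type*} [Fintype m] {M N : Matrix m m ℚ_[p]}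
    (hM : ∀ i j, ‖M i j‖ ≤ 1) (hN : ∀ i j, ‖N i j‖ ≤ 1) (i j : m) : ‖(M * N) i j‖ ≤ 1 :=
  show ∑ k, M i k * N k j ∈ PadicInt.subring p from
    sum_mem fun k _ => mul_mem (show M i k ∈ PadicInt.subring p from hM i k) (hN k j)

theorem norm_J_apply_le_one (i j : Fin n ⊕ Fin n) : ‖J (Fin n) ℚ_[p] i j‖ ≤ 1 := by
  rcases i with i | i <;> rcases j with j | j <;> by_cases hij : i = j <;>
    simp [J, hij]

theorem norm_inv_apply_le_one {k : Matrix (Fin n ⊕ Fin n) (Fin n ⊕ Fin n) ℚ_[p]}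
    (hk : k ∈ symplecticGroup (Fin n) ℚ_[p]) (hk1 : ∀ i j, ‖k i j‖ ≤ 1) (i j : Fin n ⊕ Fin n) :
    ‖k⁻¹ i j‖ ≤ 1 := by
  rw [SymplecticGroup.inv_eq_symplectic_inv k hk]
  refine norm_mul_apply_le_one (norm_mul_apply_le_one (fun i j => ?_) fun i j => hk1 j i)
    norm_J_apply_le_one i j
  rw [neg_apply, norm_neg]
  exact norm_J_apply_le_one i j

theorem padicWedgeNorm_Pl_mul {m : Matrix (Fin n ⊕ Fin n) (Fin n ⊕ Fin n) ℚ_[p]}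
    (hm : m.toBlocks₂₁ = 0) (g : Matrix (Fin n ⊕ Fin n) (Fin n ⊕ Fin n) ℚ_[p]) :
    padicWedgeNorm p n (Pl ℚ_[p] n (m * g)) =
      ‖m.toBlocks₂₂.det‖ * padicWedgeNorm p n (Pl ℚ_[p] n g) := by
  rw [padicWedgeNorm, padicWedgeNorm, Real.mul_iSup_of_nonneg (norm_nonneg _)]
  congr! 2 with s
  rw [detCoord_Pl, detCoord_Pl, ← norm_mul, ← det_mul]
  congr 2
  obtain ⟨h1, h2⟩ := toBlocks_mul_of_toBlocks₂₁_eq_zero hm g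
  ext i j
  rw [submatrix_apply]
  rcases hc : colsOf n s.1 s.2 j with k | k
  · have := congrFun (congrFun h1 i) k
    simpa [mul_apply, toBlocks₂₁, hc] using this
  · have := congrFun (congrFun h2 i) k
    simpa [mul_apply, toBlocks₂₂, hc] using this

theorem padicWedgeNorm_Pl_le_one {k : Matrix (Fin n ⊕ Fin n) (Fin n ⊕ Fin n) ℚ_[p]}
    (hk : ∀ i j, ‖k i j‖ ≤ 1) : padicWedgeNorm p n (Pl ℚ_[p] n k) ≤ 1 := by
  refine Real.iSup_le (fun s => ?_) zero_le_one
  rw [detCoord_Pl]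
  exact norm_det_le_one fun i j => hk _ _

theorem norm_minor_le_padicWedgeNorm (g : Matrix (Fin n ⊕ Fin n) (Fin n ⊕ Fin n) ℚ_[p])
    {c : Fin n → Fin n ⊕ Fin n} (hc : Function.Injective c) :
    ‖(g.submatrix Sum.inr c).det‖ ≤ padicWedgeNorm p n (Pl ℚ_[p] n g) := by
  obtain ⟨s, hs, σ, rfl⟩ := exists_perm_colsOf c hc
  have h1 : ‖(g.submatrix Sum.inr (colsOf n s hs ∘ σ)).det‖ =
      ‖detCoord ℚ_[p] n s hs (Pl ℚ_[p] n g)‖ := by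
    rw [detCoord_Pl]
    have := det_permute' σ (g.submatrix Sum.inr (colsOf n s hs))
    rw [submatrix_submatrix, Function.comp_id] at this
    rw [this]
    rcases Int.units_eq_one_or (Equiv.Perm.sign σ) with h | h <;> simp [h]
  rw [h1]
  exact le_ciSup (f := fun s : {s : Finset (Fin n ⊕ Fin n) // s.card = n} =>
    ‖detCoord ℚ_[p] n s.1 s.2 (Pl ℚ_[p] n g)‖) (Set.finite_range _).bddAbove ⟨s, hs⟩

/-- A Lagrangian coordinate plane with Plücker coordinate of maximal norm can be moved to the
last `n` coordinates. -/
theorem exists_exchange_maximal {g : Matrix (Fin n ⊕ Fin n) (Fin n ⊕ Fin n) ℚ_[p]}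
    (hg : g ∈ symplecticGroup (Fin n) ℚ_[p]) :
    ∃ S : Finset (Fin n), (g * exchange ℚ_[p] S).toBlocks₂₂.det ≠ 0 ∧
      ∀ T, ‖(mixCols T (g * exchange ℚ_[p] S).toBlocks₂₁
        (g * exchange ℚ_[p] S).toBlocks₂₂).det‖ ≤ ‖(g * exchange ℚ_[p] S).toBlocks₂₂.det‖ := by
  have hCD : g.toBlocks₂₁ * g.toBlocks₂₂ᵀ = g.toBlocks₂₂ * g.toBlocks₂₁ᵀ := by
    rw [← fromBlocks_toBlocks g, fromBlocks_mem_symplecticGroup_iff] at hg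
    exact hg.2.1
  obtain ⟨S₀, hS₀⟩ := exists_det_mixCols_ne_zero hCD fun v hC hD => by
    have h1 : Sum.elim 0 v ᵥ* g = 0 := by
      rw [← fromBlocks_toBlocks g, vecMul_fromBlocks]
      simp [hC, hD]
    have h2 := eq_zero_of_vecMul_eq_zero (SymplecticGroup.symplectic_det hg).ne_zero h1
    ext i
    exact congrFun h2 (Sum.inr i)
  obtain ⟨S, -, hS⟩ := Finset.exists_max_image Finset.univ
    (fun S => ‖(mixCols S g.toBlocks₂₁ g.toBlocks₂₂).det‖) Finset.univ_nonempty
  refine ⟨S, ?_, fun T => ?_⟩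
  · rw [toBlocks₂₂_mul_exchange, ← norm_pos_iff]
    exact (norm_pos_iff.mpr hS₀).trans_le (hS S₀ (Finset.mem_univ _))
  · rw [toBlocks₂₂_mul_exchange, toBlocks₂₁_mul_exchange, mixCols_mixCols, det_mul, norm_mul,
      det_diagonal, norm_prod]
    refine (mul_le_of_le_one_right (norm_nonneg _) ?_).trans (hS (S ∆ T) (Finset.mem_univ _))
    refine Finset.prod_le_one (fun _ _ => norm_nonneg _) fun i _ => ?_
    split_ifs <;> simp

/-- A symmetric matrix whose principal minors of size at most two are integral is integral. -/
theorem norm_apply_le_one_of_principal_minors {X : Matrix (Fin n) (Fin n) ℚ_[p]} (hX : Xᵀ = X)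
    (hminor : ∀ (m : ℕ) (f : Fin m → Fin n), Function.Injective f → ‖(X.submatrix f f).det‖ ≤ 1)
    (i j : Fin n) :
    ‖X i j‖ ≤ 1 := by
  have hdiag (i : Fin n) : ‖X i i‖ ≤ 1 := by
    simpa using hminor 1 (fun _ => i) fun _ _ _ => Subsingleton.elim _ _
  by_cases hij : i = j
  · exact hij ▸ hdiag i
  have hdet := hminor 2 ![i, j] (by
    intro a b hab
    fin_cases a <;> fin_cases b <;> simp_all [Ne.symm hij])
  have hsymm : X j i = X i j := congrFun (congrFun hX i) j
  simp only [det_fin_two, submatrix_apply, cons_val_zero,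
    cons_val_one, hsymm] at hdet
  have hsq : X i j * X i j ∈ PadicInt.subring p := by
    have h1 : X i i * X j j ∈ PadicInt.subring p :=
      mul_mem (show X i i ∈ PadicInt.subring p from hdiag i) (hdiag j)
    simpa using sub_mem h1 hdet
  rw [PadicInt.mem_subring_iff, norm_mul] at hsq
  nlinarith [norm_nonneg (X i j)]

/-- Iwasawa decomposition of the symplectic group with respect to the Siegel parabolic. -/
theorem exists_iwasawa {g : Matrix (Fin n ⊕ Fin n) (Fin n ⊕ Fin n) ℚ_[p]}
    (hg : g ∈ symplecticGroup (Fin n) ℚ_[p]) :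
    ∃ m ∈ symplecticGroup (Fin n) ℚ_[p], m.toBlocks₂₁ = 0 ∧
      ∃ k ∈ symplecticGroup (Fin n) ℚ_[p], (∀ i j, ‖k i j‖ ≤ 1) ∧
        1 ≤ padicWedgeNorm p n (Pl ℚ_[p] n k) ∧ g = m * k := by
  obtain ⟨S, hdet, hmax⟩ := exists_exchange_maximal hg
  set w := exchange ℚ_[p] S
  have hw : w ∈ symplecticGroup (Fin n) ℚ_[p] := exchange_mem S
  have hgw := mul_mem hg hw
  have hw1 (i j) : ‖w i j‖ ≤ 1 := by
    rcases i with i | i <;> rcases j with j | j <;> by_cases hij : i = j <;>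
      by_cases hi : j ∈ S <;> simp [w, exchange, hij, hi]
  set A := (g * w).toBlocks₁₁
  set B := (g * w).toBlocks₁₂
  set C := (g * w).toBlocks₂₁
  set D := (g * w).toBlocks₂₂
  have hD : IsUnit D.det := isUnit_iff_ne_zero.mpr hdet
  have hCD : C * Dᵀ = D * Cᵀ := by
    rw [← fromBlocks_toBlocks (g * w), fromBlocks_mem_symplecticGroup_iff] at hgw
    exact hgw.2.1
  set X := D⁻¹ * C with hXdef
  have hDX : D * X = C := mul_nonsing_inv_cancel_left D C hD
  have hXt : Xᵀ = X := by
    have hDt : IsUnit Dᵀ.det := by rwa [det_transpose]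
    rw [hXdef, transpose_mul, transpose_nonsing_inv]
    calc Cᵀ * Dᵀ⁻¹ = D⁻¹ * (D * Cᵀ) * Dᵀ⁻¹ := by rw [nonsing_inv_mul_cancel_left _ _ hD]
      _ = D⁻¹ * C := by
        rw [← hCD, Matrix.mul_assoc, mul_nonsing_inv_cancel_right _ _ hDt]
  have hX1 : ∀ i j, ‖X i j‖ ≤ 1 := by
    refine norm_apply_le_one_of_principal_minors hXt fun m f hf => ?_
    have h1 := hmax (Finset.univ.map ⟨f, hf⟩)
    rw [show mixCols (Finset.univ.map ⟨f, hf⟩) C D =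
      D * mixCols (Finset.univ.map ⟨f, hf⟩) X 1 by
      rw [mul_mixCols, hDX, mul_one], det_mul, norm_mul, det_mixCols_one] at h1
    exact (mul_le_iff_le_one_right (norm_pos_iff.mpr hdet)).mp h1
  let l : Matrix (Fin n ⊕ Fin n) (Fin n ⊕ Fin n) ℚ_[p] := fromBlocks 1 0 X 1
  have hl : l ∈ symplecticGroup (Fin n) ℚ_[p] := by
    simp [l, fromBlocks_mem_symplecticGroup_iff, hXt]
  have hl1 (i j) : ‖l i j‖ ≤ 1 := by
    rcases i with i | i <;> rcases j with j | j <;> by_cases hij : i = j <;>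
      simp [l, hij, hX1]
  have hlu := SymplecticGroup.symplectic_det hl
  have hwu := SymplecticGroup.symplectic_det hw
  have hl' : l⁻¹ = fromBlocks 1 0 (-X) 1 := inv_eq_left_inv (by
    simp [l, fromBlocks_multiply])
  refine ⟨g * w * l⁻¹, mul_mem hgw (inv_mem_symplecticGroup hl), ?_, l * w⁻¹,
    mul_mem hl (inv_mem_symplecticGroup hw),
    norm_mul_apply_le_one hl1 (norm_inv_apply_le_one hw hw1), ?_, ?_⟩
  · rw [hl', ← fromBlocks_toBlocks (g * w), fromBlocks_multiply, toBlocks_fromBlocks₂₁]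
    change C * 1 + D * (-X) = 0
    rw [Matrix.mul_one, Matrix.mul_neg, hDX, add_neg_cancel]
  · have hc : Function.Injective fun j : Fin n => if j ∈ S then Sum.inl j else Sum.inr j := by
      intro i j hij
      by_cases hi : i ∈ S <;> by_cases hj : j ∈ S <;> simp_all
    refine le_trans (le_of_eq ?_) (norm_minor_le_padicWedgeNorm (l * w⁻¹) hc)
    rw [show (l * w⁻¹).submatrix Sum.inr (fun j : Fin n => if j ∈ S then Sum.inl j else Sum.inr j)
      = (l * w⁻¹ * w).toBlocks₂₂ by
        rw [toBlocks₂₂_mul_exchange]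
        ext i j
        by_cases hj : j ∈ S <;> simp [mixCols, hj, toBlocks₂₁, toBlocks₂₂],
      nonsing_inv_mul_cancel_right _ _ hwu]
    simp [l]
  · rw [← Matrix.mul_assoc, nonsing_inv_mul_cancel_right _ _ hlu,
      mul_nonsing_inv_cancel_right _ _ hwu]

theorem padicWedgeNorm_Pl_eq_one {k : Matrix (Fin n ⊕ Fin n) (Fin n ⊕ Fin n) ℚ_[p]}
    (hk : k ∈ symplecticGroup (Fin n) ℚ_[p]) (hk1 : ∀ i j, ‖k i j‖ ≤ 1) :
    padicWedgeNorm p n (Pl ℚ_[p] n k) = 1 := by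
  refine le_antisymm (padicWedgeNorm_Pl_le_one hk1) ?_
  obtain ⟨m, hm, hm0, k', hk', hk'1, hnorm, rfl⟩ := exists_iwasawa hk
  have hm1 (i j) : ‖m i j‖ ≤ 1 := by
    have := norm_mul_apply_le_one hk1 (norm_inv_apply_le_one hk' hk'1) i j
    rwa [mul_nonsing_inv_cancel_right _ _ (SymplecticGroup.symplectic_det hk')] at this
  have hdet : 1 ≤ ‖m.toBlocks₂₂.det‖ := by
    have h1 := congrArg (fun M => ‖det M‖) (mul_toBlocks₂₂_transpose_eq_one hm hm0)
    simp only [det_mul, det_transpose, norm_mul, det_one, norm_one] at h1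
    rw [← h1]
    exact mul_le_of_le_one_left (norm_nonneg _) (norm_det_le_one fun i j => hm1 _ _)
  rw [padicWedgeNorm_Pl_mul hm0]
  exact one_le_mul_of_one_le_of_one_le hdet hnorm

/-- The diagonal torus contains integral elements whose lower block has any given unit as
determinant. -/
theorem exists_integral_torus (hn : 1 ≤ n) {u : ℚ_[p]} (hu : ‖u‖ = 1) :
    ∃ t ∈ symplecticGroup (Fin n) ℚ_[p], (∀ i j, ‖t i j‖ ≤ 1) ∧ t.toBlocks₂₁ = 0 ∧
      t.toBlocks₂₂.det = u := by
  have hu0 : u ≠ 0 := norm_ne_zero_iff.mp (by rw [hu]; exact one_ne_zero)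
  let d : Fin n → ℚ_[p] := Function.update 1 ⟨0, hn⟩ u
  have hd (i) : ‖d i‖ = 1 := by
    by_cases hi : i = ⟨0, hn⟩
    · rw [hi]; simp [d, hu]
    · simp [d, hi]
  have hd0 (i) : d i ≠ 0 := norm_ne_zero_iff.mp (by rw [hd]; exact one_ne_zero)
  refine ⟨fromBlocks (diagonal d⁻¹) 0 0 (diagonal d), ?_, fun i j => ?_, by simp, ?_⟩
  · rw [fromBlocks_mem_symplecticGroup_iff]
    simp [hd0]
  · rcases i with i | i <;> rcases j with j | j <;> by_cases hij : i = j <;>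
      simp [hij, hd]
  · rw [toBlocks_fromBlocks₂₂, det_diagonal, Finset.prod_update_of_mem (Finset.mem_univ _)]
    simp

end Padic

/-- For `g, h ∈ Sp_{2n}(ℚ_p)`: `|Pl(g)|_p = |Pl(h)|_p` iff `g = q·h·k` for some
`q ∈ [P,P](ℚ_p)` and `k ∈ Sp_{2n}(ℤ_p)`.  I.e., the map
`X(ℚ_p)/Sp_{2n}(ℤ_p) → ℝ_{>0}` sending `[P,P](ℚ_p) g Sp_{2n}(ℤ_p) ↦ |Pl(g)|_p` is a
well-defined injection. -/
theorem plNorm_eq_iff_same_double_coset (p : ℕ) [Fact p.Prime] (n : ℕ) (hn : 1 ≤ n)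
    (g h : Matrix (Fin n ⊕ Fin n) (Fin n ⊕ Fin n) ℚ_[p])
    (hg : g ∈ Sp ℚ_[p] n) (hh : h ∈ Sp ℚ_[p] n) :
    padicWedgeNorm p n (Pl ℚ_[p] n g) = padicWedgeNorm p n (Pl ℚ_[p] n h) ↔
      ∃ q ∈ SiegelPP ℚ_[p] n, ∃ k ∈ Sp ℚ_[p] n, (∀ i j, ‖k i j‖ ≤ 1) ∧ g = q * h * k := by
  rw [mem_Sp_iff] at hg hh
  constructor
  · intro heq
    obtain ⟨m, hm, hm0, k, hk, hk1, -, rfl⟩ := exists_iwasawa hg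
    obtain ⟨m', hm', hm'0, k', hk', hk'1, -, rfl⟩ := exists_iwasawa hh
    rw [padicWedgeNorm_Pl_mul hm0, padicWedgeNorm_Pl_mul hm'0, padicWedgeNorm_Pl_eq_one hk hk1,
      padicWedgeNorm_Pl_eq_one hk' hk'1, mul_one, mul_one] at heq
    have hdet {x : Matrix (Fin n ⊕ Fin n) (Fin n ⊕ Fin n) ℚ_[p]}
        (hx : x ∈ symplecticGroup (Fin n) ℚ_[p]) (hx0 : x.toBlocks₂₁ = 0) :
        x.toBlocks₂₂.det ≠ 0 := fun h => by
      have := congrArg det (mul_toBlocks₂₂_transpose_eq_one hx hx0)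
      simp [h] at this
    have hne := hdet hm hm0
    have hne' := hdet hm' hm'0
    obtain ⟨t, ht, ht1, ht0, htdet⟩ := exists_integral_torus (p := p) hn
      (u := m.toBlocks₂₂.det / m'.toBlocks₂₂.det)
      (by rw [norm_div, heq, div_self (norm_ne_zero_iff.mpr hne')])
    have hmt : m' * t ∈ symplecticGroup (Fin n) ℚ_[p] := mul_mem hm' ht
    have hmt0 : (m' * t).toBlocks₂₁ = 0 := by
      rw [(toBlocks_mul_of_toBlocks₂₁_eq_zero hm'0 t).1, ht0, Matrix.mul_zero]
    have hmtdet : (m' * t).toBlocks₂₂.det = m.toBlocks₂₂.det := by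
      rw [(toBlocks_mul_of_toBlocks₂₁_eq_zero hm'0 t).2, det_mul, htdet, mul_div_cancel₀ _ hne']
    have hq : m * (m' * t)⁻¹ * (m' * t) = m :=
      nonsing_inv_mul_cancel_right _ _ (SymplecticGroup.symplectic_det hmt)
    have hq0 : (m * (m' * t)⁻¹).toBlocks₂₁ = 0 := by
      rw [(toBlocks_mul_of_toBlocks₂₁_eq_zero hm0 _).1, toBlocks₂₁_inv hmt hmt0, Matrix.mul_zero]
    refine ⟨m * (m' * t)⁻¹, mem_SiegelPP_of_det (mul_mem hm (inv_mem_symplecticGroup hmt)) hq0 ?_,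
      k'⁻¹ * t * k, mem_Sp_iff.mpr (mul_mem (mul_mem (inv_mem_symplecticGroup hk') ht) hk),
      norm_mul_apply_le_one (norm_mul_apply_le_one (norm_inv_apply_le_one hk' hk'1) ht1) hk1, ?_⟩
    · have h2 := congrArg det (toBlocks_mul_of_toBlocks₂₁_eq_zero hq0 (m' * t)).2
      rw [hq, det_mul, hmtdet] at h2
      exact (mul_eq_right₀ hne).mp h2.symm
    · calc m * k = m * (m' * t)⁻¹ * (m' * t) * k := by rw [hq]
        _ = m * (m' * t)⁻¹ * (m' * (k' * k'⁻¹) * t) * k := by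
          rw [mul_nonsing_inv _ (SymplecticGroup.symplectic_det hk'), Matrix.mul_one]
        _ = m * (m' * t)⁻¹ * (m' * k') * (k'⁻¹ * t * k) := by simp only [Matrix.mul_assoc]
  · rintro ⟨q, ⟨-, A, B, hqAB, hA⟩, k, hk, hk1, rfl⟩
    rw [mem_Sp_iff] at hk
    have hq0 : q.toBlocks₂₁ = 0 := by rw [hqAB, toBlocks_fromBlocks₂₁]
    have hqdet : q.toBlocks₂₂.det = 1 := by
      rw [hqAB, toBlocks_fromBlocks₂₂, det_nonsing_inv, det_transpose, hA, Ring.inverse_one]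
    obtain ⟨m, -, hm0, k', hk', hk'1, -, rfl⟩ := exists_iwasawa hh
    rw [Matrix.mul_assoc, padicWedgeNorm_Pl_mul hq0, hqdet, norm_one, one_mul, Matrix.mul_assoc,
      padicWedgeNorm_Pl_mul hm0, padicWedgeNorm_Pl_mul hm0, padicWedgeNorm_Pl_eq_one hk' hk'1,
      padicWedgeNorm_Pl_eq_one (mul_mem hk' hk) (norm_mul_apply_le_one hk'1 hk1)]
end

section
/- Let n ≥ 1, t ∈ ℝ, and α ∈ {0,1}. Define Γ_ℝ(w) := π^{−w/2}Γ(w/2), and set d_{t,α}(s) := Γ_ℝ(s + (n+1)/2 + it + α) · Π_{r=1}^{⌊n/2⌋} Γ_ℝ(2s + n + 1 − 2r + 2it) and a_{t,α}(s) := Γ_ℝ(s + (1−n)/2 + it + α) · Π_{r=1}^{⌊n/2⌋} Γ_ℝ(2s − n + 2r + 2it). Let A ≤ B be real numbers and let P₁, P₂ ∈ ℂ[s] be polynomials such that the functions s ↦ P₁(s)·d_{−t,α}(−s) and s ↦ P₂(s)·a_{t,α}(s) extend to holomorphic, nowhere-vanishing functions on the strip V_{A,B} = {A ≤ Re(s)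 ≤ B}. Then there exists a polynomial Q ∈ ℂ[s] such that |P₁(s)·d_{−t,α}(−s)| ≤ |Q(s)| · |P₂(s)·a_{t,α}(s)| for all s ∈ V_{A,B} (values at poles interpreted via the holomorphic extensions). (This is Lemma 3.1 (lem:gamma:poly) at a real place: here d_{t,α}(s) = a_{Id}(s,χ) and a_{t,α}(s) = a_{w₀}(s,χ) for the character χ = |·|^{it}·sgn^α of ℝ^×, and χ̄ corresponds to replacing t by −t.) -/
open Complex

/-- The real archimedean `L`-factor `Γ_ℝ(w) = π^{−w/2} Γ(w/2)`. -/
noncomputable def GammaR (w : ℂ) : ℂ := (Real.pi : ℂ) ^ (-w / 2) * Complex.Gamma (w / 2)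

/-- `d_{t,α}(s) = Γ_ℝ(s + (n+1)/2 + it + α) · Π_{r=1}^{⌊n/2⌋} Γ_ℝ(2s + n + 1 − 2r + 2it)`,
the normalizing factor `a_{Id}(s,χ) = d(s,χ)` for the character `χ = |·|^{it} sgn^α` of
`ℝ^×`. -/
noncomputable def dFun (n : ℕ) (t : ℝ) (α : ℕ) (s : ℂ) : ℂ :=
  GammaR (s + ((n : ℂ) + 1) / 2 + (t : ℂ) * Complex.I + (α : ℂ)) *
    ∏ r ∈ Finset.Icc 1 (n / 2),
      GammaR (2 * s + (n : ℂ) + 1 - 2 * (r : ℂ) + 2 * (t : ℂ) * Complex.I)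

/-- `a_{t,α}(s) = Γ_ℝ(s + (1−n)/2 + it + α) · Π_{r=1}^{⌊n/2⌋} Γ_ℝ(2s − n + 2r + 2it)`, the
factor `a_{w₀}(s,χ)` for the character `χ = |·|^{it} sgn^α` of `ℝ^×`. -/
noncomputable def aFun (n : ℕ) (t : ℝ) (α : ℕ) (s : ℂ) : ℂ :=
  GammaR (s + (1 - (n : ℂ)) / 2 + (t : ℂ) * Complex.I + (α : ℂ)) *
    ∏ r ∈ Finset.Icc 1 (n / 2),
      GammaR (2 * s - (n : ℂ) + 2 * (r : ℂ) + 2 * (t : ℂ) * Complex.I)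

section GammaBounds

/-- Shifting the argument to the right by a real `δ ≥ 1` shrinks `|Γ|` at most by `Γ(δ)`. -/
theorem norm_Gamma_mul_Gamma_le_norm_Gamma_add {z : ℂ} {δ : ℝ} (hz : 1 ≤ z.re) (hδ : 1 ≤ δ) :
    ‖Gamma z‖ * Real.Gamma δ ≤ ‖Gamma (z + δ)‖ := by
  have hbeta : ‖betaIntegral z δ‖ ≤ 1 := by
    have h := intervalIntegral.norm_integral_le_of_norm_le_const (a := (0 : ℝ)) (b := 1) (C := 1)
      (f := fun x : ℝ => (x : ℂ) ^ (z - 1) * (1 - (x : ℂ)) ^ ((δ : ℂ) - 1)) ?_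
    · simpa [betaIntegral] using h
    · intro x hx
      rw [Set.uIoc_of_le zero_le_one] at hx
      have h1 : ‖(x : ℂ) ^ (z - 1)‖ ≤ 1 := by
        rw [norm_cpow_eq_rpow_re_of_pos hx.1]
        exact Real.rpow_le_one hx.1.le hx.2 (by simpa using hz)
      have h2 : ‖(1 - (x : ℂ)) ^ ((δ : ℂ) - 1)‖ ≤ 1 := by
        have hc : (1 - (x : ℂ)) ^ ((δ : ℂ) - 1) = (((1 - x) ^ (δ - 1) : ℝ) : ℂ) := by
          rw [ofReal_cpow (by linarith [hx.2])]
          push_cast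
          rfl
        rw [hc, norm_real, Real.norm_of_nonneg (Real.rpow_nonneg (by linarith [hx.2]) _)]
        exact Real.rpow_le_one (by linarith [hx.2]) (by linarith [hx.1]) (by linarith)
      rw [norm_mul]
      exact mul_le_one₀ h1 (norm_nonneg _) h2
  have key := Gamma_mul_Gamma_eq_betaIntegral (s := z) (t := (δ : ℂ)) (by linarith)
    (by rw [ofReal_re]; linarith)
  have hn := congrArg norm key
  rw [norm_mul, norm_mul, Gamma_ofReal, norm_real,
    Real.norm_of_nonneg (Real.Gamma_pos_of_pos (by linarith)).le] at hn
  rw [hn]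
  exact mul_le_of_le_one_right (norm_nonneg _) hbeta

theorem norm_Gamma_le_norm_Gamma_add_nat {z : ℂ} (hz : 1 ≤ |z.im|) (m : ℕ) :
    ‖Gamma z‖ ≤ ‖Gamma (z + m)‖ := by
  induction m with
  | zero => simp
  | succ m ih =>
    have h1 : 1 ≤ ‖z + m‖ := by
      refine le_trans ?_ (abs_im_le_norm _)
      simpa using hz
    have h0 : z + m ≠ 0 := norm_pos_iff.mp (by linarith)
    rw [Nat.cast_succ, ← add_assoc, Gamma_add_one _ h0, norm_mul]
    exact ih.trans (le_mul_of_one_le_left (norm_nonneg _) h1)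

theorem norm_Gamma_add_nat_le {w : ℂ} (hw : w.im ≠ 0) (m : ℕ) :
    ‖Gamma (w + m)‖ ≤ (‖w‖ + m) ^ m * ‖Gamma w‖ := by
  induction m with
  | zero => simp
  | succ m ih =>
    have h0 : w + m ≠ 0 := fun h => hw (by simpa using congrArg im h)
    have h1 : ‖w + m‖ ≤ ‖w‖ + m := by simpa using norm_add_le w (m : ℂ)
    rw [Nat.cast_succ, ← add_assoc, Gamma_add_one _ h0, norm_mul]
    calc ‖w + m‖ * ‖Gamma (w + m)‖
        ≤ (‖w‖ + m) * ((‖w‖ + m) ^ m * ‖Gamma w‖) := by gcongr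
      _ = (‖w‖ + m) ^ (m + 1) * ‖Gamma w‖ := by ring
      _ ≤ (‖w‖ + (m + 1)) ^ (m + 1) * ‖Gamma w‖ := by gcongr; linarith
      _ = _ := by push_cast; rfl

/-- In a vertical strip, the values of `|Γ|` at two points with opposite imaginary parts are
comparable up to a polynomial factor. -/
theorem exists_norm_Gamma_le (a b : ℝ) : ∃ C : ℝ, 0 ≤ C ∧ ∃ N : ℕ, ∀ z w : ℂ,
    a ≤ z.re → z.re ≤ b → a ≤ w.re → w.re ≤ b → z.im = -w.im → 1 ≤ |w.im| →
    ‖Gamma z‖ ≤ C * (‖w‖ + N) ^ N * ‖Gamma w‖ := by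
  obtain ⟨m, hm⟩ := exists_nat_ge (1 - a)
  obtain ⟨k, hk⟩ := exists_nat_ge (b - a + 1)
  obtain ⟨c, hc, hcΓ⟩ : ∃ c : ℝ, 0 < c ∧ ∀ δ ∈ Set.Icc (1 : ℝ) (b - a + k), c ≤ Real.Gamma δ := by
    refine isCompact_Icc.exists_forall_le' (f := Real.Gamma) (a := 0) ?_ ?_
    · intro δ hδ
      refine (Real.differentiableAt_Gamma fun j hj => ?_).continuousAt.continuousWithinAt
      linarith [hδ.1, j.cast_nonneg (α := ℝ)]
    · intro δ hδ
      exact Real.Gamma_pos_of_pos (by linarith [hδ.1])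
  refine ⟨c⁻¹, by positivity, m + k, fun z w hz₁ hz₂ hw₁ hw₂ him hw => ?_⟩
  have hconj : ‖Gamma z‖ = ‖Gamma (starRingEnd ℂ z)‖ := by rw [Gamma_conj, norm_conj]
  set z' := starRingEnd ℂ z with hz'
  have hre : z'.re = z.re := conj_re z
  have him' : z'.im = w.im := by rw [hz', conj_im, him, neg_neg]
  set δ : ℝ := w.re + k - z.re with hδ
  have hsum : z' + m + δ = w + (m + k : ℕ) := by
    apply Complex.ext
    · simp [hre, hδ]; ring
    · simp [him']
  have h1 := norm_Gamma_le_norm_Gamma_add_nat (z := z') (by rwa [him']) m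
  have h2 := norm_Gamma_mul_Gamma_le_norm_Gamma_add (z := z' + m) (δ := δ)
    (by simp [hre]; linarith) (by linarith)
  have h3 := norm_Gamma_add_nat_le (w := w) (fun h => by norm_num [h] at hw) (m + k)
  rw [hsum] at h2
  have h4 := hcΓ δ ⟨by linarith, by linarith⟩
  rw [hconj, mul_assoc, ← div_eq_inv_mul, le_div_iff₀ hc]
  calc ‖Gamma z'‖ * c ≤ ‖Gamma (z' + m)‖ * Real.Gamma δ := by gcongr
    _ ≤ _ := h2.trans h3

theorem exists_norm_GammaR_le (a b : ℝ) : ∃ C : ℝ, 0 ≤ C ∧ ∃ N : ℕ, ∀ z w : ℂ,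
    a ≤ z.re → z.re ≤ b → a ≤ w.re → w.re ≤ b → z.im = -w.im → 2 ≤ |w.im| →
    ‖GammaR z‖ ≤ C * (‖w‖ + N) ^ N * ‖GammaR w‖ := by
  obtain ⟨C, hC, N, h⟩ := exists_norm_Gamma_le (a / 2) (b / 2)
  refine ⟨Real.pi ^ ((b - a) / 2) * C, by positivity, N, fun z w hz₁ hz₂ hw₁ hw₂ him hw => ?_⟩
  have hre : ∀ u : ℂ, (u / 2).re = u.re / 2 := fun u => by simp
  have him2 : ∀ u : ℂ, (u / 2).im = u.im / 2 := fun u => by simp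
  have hΓ := h (z / 2) (w / 2) (by rw [hre]; linarith) (by rw [hre]; linarith)
    (by rw [hre]; linarith) (by rw [hre]; linarith) (by rw [him2, him2, him]; ring)
    (by rw [him2, abs_div, abs_two]; linarith)
  have hw2 : ‖w / 2‖ ≤ ‖w‖ := by
    rw [norm_div, Complex.norm_two]
    linarith [norm_nonneg w]
  have hπ : ‖(Real.pi : ℂ) ^ (-z / 2)‖ ≤
      Real.pi ^ ((b - a) / 2) * ‖(Real.pi : ℂ) ^ (-w / 2)‖ := by
    rw [norm_cpow_eq_rpow_re_of_pos Real.pi_pos, norm_cpow_eq_rpow_re_of_pos Real.pi_pos,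
      ← Real.rpow_add Real.pi_pos]
    refine Real.rpow_le_rpow_of_exponent_le (by linarith [Real.pi_gt_three]) ?_
    rw [hre, hre, neg_re, neg_re]
    linarith
  rw [GammaR, GammaR, norm_mul, norm_mul]
  calc ‖(Real.pi : ℂ) ^ (-z / 2)‖ * ‖Gamma (z / 2)‖
      ≤ (Real.pi ^ ((b - a) / 2) * ‖(Real.pi : ℂ) ^ (-w / 2)‖) *
        (C * (‖w‖ + N) ^ N * ‖Gamma (w / 2)‖) := by
        gcongr
        exact hΓ.trans (by gcongr)
    _ = _ := by ring

theorem GammaR_ne_zero_of_im_ne_zero {w : ℂ} (hw : w.im ≠ 0) : GammaR w ≠ 0 := by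
  refine mul_ne_zero ?_ (Gamma_ne_zero fun m hm => hw ?_)
  · rw [Ne, cpow_eq_zero_iff]
    simp [Real.pi_ne_zero]
  · simpa using congrArg im hm

end GammaBounds

section PolynomialGrowth

open Filter Asymptotics

/-- The filter of points tending to infinity inside the strip `A ≤ Re s ≤ B`. -/
def stripEnds (A B : ℝ) : Filter ℂ :=
  comap (fun s : ℂ => |s.im|) atTop ⊓ 𝓟 {s | A ≤ s.re ∧ s.re ≤ B}

variable {A B : ℝ}

theorem eventually_stripEnds_iff {p : ℂ → Prop} : (∀ᶠ s in stripEnds A B, p s) ↔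
    ∃ T : ℝ, ∀ s : ℂ, A ≤ s.re → s.re ≤ B → T ≤ |s.im| → p s := by
  rw [stripEnds, eventually_inf_principal, eventually_comap, eventually_atTop]
  constructor
  · rintro ⟨T, hT⟩
    exact ⟨T, fun s h₁ h₂ h => hT _ h s rfl ⟨h₁, h₂⟩⟩
  · rintro ⟨T, hT⟩
    exact ⟨T, fun x hx s hs h => hT s h.1 h.2 (hs ▸ hx)⟩

theorem tendsto_norm_stripEnds : Tendsto (fun s : ℂ => ‖s‖) (stripEnds A B) atTop := by
  refine tendsto_atTop_mono abs_im_le_norm ?_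
  exact tendsto_comap.mono_left inf_le_left

theorem const_isBigO_id_stripEnds (c : ℂ) :
    (fun _ : ℂ => c) =O[stripEnds A B] fun s : ℂ => s :=
  (isLittleO_const_left.mpr (Or.inr tendsto_norm_stripEnds)).isBigO

/-- `F` is bounded by a power of `s` times `G` at the ends of the strip. -/
def PolyBounded (A B : ℝ) (F G : ℂ → ℂ) : Prop :=
  ∃ N : ℕ, F =O[stripEnds A B] fun s => s ^ N * G s

theorem PolyBounded.mul {F₁ G₁ F₂ G₂ : ℂ → ℂ} (h₁ : PolyBounded A B F₁ G₁)
    (h₂ : PolyBounded A B F₂ G₂) :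
    PolyBounded A B (fun s => F₁ s * F₂ s) fun s => G₁ s * G₂ s := by
  obtain ⟨N₁, h₁⟩ := h₁
  obtain ⟨N₂, h₂⟩ := h₂
  refine ⟨N₁ + N₂, (h₁.mul h₂).congr_right fun s => ?_⟩
  ring_nf

theorem PolyBounded.finset_prod {ι : Type*} (S : Finset ι) {F G : ι → ℂ → ℂ}
    (h : ∀ i, PolyBounded A B (F i) (G i)) :
    PolyBounded A B (fun s => ∏ i ∈ S, F i s) fun s => ∏ i ∈ S, G i s := by
  classical
  induction S using Finset.induction_on with
  | empty => exact ⟨0, by simpa using isBigO_refl (fun _ : ℂ => (1 : ℂ)) _⟩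
  | insert i S hi ih => simpa only [Finset.prod_insert hi] using (h i).mul ih

theorem polynomial_eval_isBigO_pow (P : Polynomial ℂ) :
    (fun s => P.eval s) =O[stripEnds A B] fun s => s ^ P.natDegree := by
  simp only [Polynomial.eval_eq_sum_range]
  refine IsBigO.fun_sum fun i hi => IsBigO.const_mul_left ?_ _
  refine IsBigO.of_bound 1 ?_
  filter_upwards [tendsto_norm_stripEnds.eventually_ge_atTop 1] with s hs
  rw [one_mul, norm_pow, norm_pow]
  exact pow_le_pow_right₀ hs (by simpa [Nat.lt_succ_iff] using hi)

theorem one_isBigO_polynomial_eval {P : Polynomial ℂ} (hP : P ≠ 0) :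
    (fun _ => (1 : ℂ)) =O[stripEnds A B] fun s => P.eval s := by
  rcases le_or_gt P.degree 0 with h | h
  · rw [Polynomial.eq_C_of_degree_le_zero h] at hP ⊢
    simp only [Polynomial.eval_C]
    exact isBigO_const_const _ (by simpa using hP) _
  · exact (isLittleO_const_left.mpr
      (Or.inr (P.tendsto_norm_atTop h tendsto_norm_stripEnds))).isBigO

theorem PolyBounded.polynomial_eval (P : Polynomial ℂ) {Q : Polynomial ℂ} (hQ : Q ≠ 0) :
    PolyBounded A B (fun s => P.eval s) fun s => Q.eval s :=
  ⟨P.natDegree, by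
    simpa using (polynomial_eval_isBigO_pow P).mul (one_isBigO_polynomial_eval hQ)⟩

theorem PolyBounded.gammaR {k : ℝ} (hk : 1 ≤ k) (c c' t : ℝ) :
    PolyBounded A B (fun s => GammaR (-(k * s) + c - k * t * I))
      fun s => GammaR (k * s + c' + k * t * I) := by
  obtain ⟨C, hC, N, h⟩ := exists_norm_GammaR_le (min (-(k * B) + c) (k * A + c'))
    (max (-(k * A) + c) (k * B + c'))
  have hlin : (fun s : ℂ => ‖(k * s + c' + k * t * I : ℂ)‖ + N) =O[stripEnds A B] fun s => s := by
    refine IsBigO.add (IsBigO.norm_left (((isBigO_refl _ _).const_mul_left _).add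
      (const_isBigO_id_stripEnds _) |>.add (const_isBigO_id_stripEnds _))) ?_
    simpa using (const_isBigO_id_stripEnds (A := A) (B := B) (N : ℂ)).norm_left
  refine ⟨N, IsBigO.trans (IsBigO.of_bound C ?_) ((hlin.pow N).smul (isBigO_refl _ _))⟩
  rw [eventually_stripEnds_iff]
  refine ⟨2 + |t|, fun s hA hB hs => ?_⟩
  have hk0 : 0 ≤ k := by linarith
  have hkA := mul_le_mul_of_nonneg_left hA hk0
  have hkB := mul_le_mul_of_nonneg_left hB hk0
  have hre : (-(k * s) + c - k * t * I : ℂ).re = -(k * s.re) + c := by simp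
  have hre' : (k * s + c' + k * t * I : ℂ).re = k * s.re + c' := by simp
  have him : (-(k * s) + c - k * t * I : ℂ).im = -(k * (s.im + t)) := by simp; ring
  have him' : (k * s + c' + k * t * I : ℂ).im = k * (s.im + t) := by simp; ring
  have hlarge : 2 ≤ |k * (s.im + t)| := by
    have h2 : 2 ≤ |s.im + t| := by
      have := abs_sub_abs_le_abs_sub s.im (-t)
      rw [abs_neg, sub_neg_eq_add] at this
      linarith
    rw [abs_mul, abs_of_nonneg hk0]
    nlinarith
  have := h (-(k * s) + c - k * t * I) (k * s + c' + k * t * I)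
    (by rw [hre]; exact (min_le_left _ _).trans (by linarith))
    (by rw [hre]; exact le_trans (by linarith) (le_max_left _ _))
    (by rw [hre']; exact (min_le_right _ _).trans (by linarith))
    (by rw [hre']; exact le_trans (by linarith) (le_max_right _ _))
    (by rw [him, him']) (by rw [him']; exact hlarge)
  rw [norm_smul, norm_pow, Real.norm_of_nonneg (by positivity), ← mul_assoc]
  exact this

theorem polyBounded_dFun_aFun (n : ℕ) (t : ℝ) (α : ℕ) :
    PolyBounded A B (fun s => dFun n (-t) α (-s)) (aFun n t α) := by
  unfold aFun dFun
  refine PolyBounded.mul ?_ (PolyBounded.finset_prod _ fun r => ?_)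
  · convert PolyBounded.gammaR (A := A) (B := B) le_rfl ((n + 1) / 2 + α) ((1 - n) / 2 + α) t
      using 3 <;> push_cast <;> ring_nf
  · convert PolyBounded.gammaR (A := A) (B := B) one_le_two (n + 1 - 2 * r) (-n + 2 * r) t
      using 3 <;> push_cast <;> ring_nf

theorem dFun_ne_zero {n : ℕ} {t : ℝ} {α : ℕ} {s : ℂ} (h : s.im + t ≠ 0) : dFun n t α s ≠ 0 := by
  refine mul_ne_zero (GammaR_ne_zero_of_im_ne_zero ?_)
    (Finset.prod_ne_zero_iff.mpr fun r _ => GammaR_ne_zero_of_im_ne_zero ?_)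
  · have hn : ((n : ℂ) + 1) / 2 = (((n + 1) / 2 : ℝ) : ℂ) := by push_cast; rfl
    rw [hn]
    simpa using h
  · simpa [← mul_add] using h

theorem aFun_ne_zero {n : ℕ} {t : ℝ} {α : ℕ} {s : ℂ} (h : s.im + t ≠ 0) : aFun n t α s ≠ 0 := by
  refine mul_ne_zero (GammaR_ne_zero_of_im_ne_zero ?_)
    (Finset.prod_ne_zero_iff.mpr fun r _ => GammaR_ne_zero_of_im_ne_zero ?_)
  · simpa using h
  · simpa [← mul_add] using h

/-- If `f` and `g` are continuous on a strip, `g` does not vanish there, and `f` is polynomially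
bounded by `g` at its ends, then `f` is bounded by a polynomial times `g` on the whole strip. -/
theorem PolyBounded.exists_polynomial {f g : ℂ → ℂ} (h : PolyBounded A B f g)
    (hf : ∀ s : ℂ, A ≤ s.re → s.re ≤ B → ContinuousAt f s)
    (hg : ∀ s : ℂ, A ≤ s.re → s.re ≤ B → ContinuousAt g s)
    (hg0 : ∀ s : ℂ, A ≤ s.re → s.re ≤ B → g s ≠ 0) :
    ∃ Q : Polynomial ℂ, ∀ s : ℂ, A ≤ s.re → s.re ≤ B → ‖f s‖ ≤ ‖Q.eval s‖ * ‖g s‖ := by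
  obtain ⟨N, h⟩ := h
  obtain ⟨C, hC, h⟩ := h.exists_pos
  obtain ⟨T, hT⟩ := eventually_stripEnds_iff.mp h.bound
  obtain ⟨M, hM⟩ := (isCompact_Icc.reProdIm isCompact_Icc :
    IsCompact (Set.Icc A B ×ℂ Set.Icc (-T) T)).exists_bound_of_continuousOn
      (f := fun s => f s / g s) fun s hs =>
        ((hf s hs.1.1 hs.1.2).div (hg s hs.1.1 hs.1.2) (hg0 s hs.1.1 hs.1.2)).continuousWithinAt
  set K : ℝ := 1 + ‖((A - 1 : ℝ) : ℂ)‖ with hK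
  have hK0 : 0 < K := by positivity
  set D : ℝ := max M (C * K ^ N) with hD
  have hD0 : 0 ≤ D := le_max_of_le_right (by positivity)
  refine ⟨Polynomial.C (D : ℂ) * (Polynomial.X - Polynomial.C ((A - 1 : ℝ) : ℂ)) ^ N,
    fun s hA hB => ?_⟩
  have h1 : 1 ≤ ‖s - ((A - 1 : ℝ) : ℂ)‖ := by
    refine le_trans ?_ ((le_abs_self _).trans (abs_re_le_norm _))
    rw [sub_re, ofReal_re]
    linarith
  simp only [Polynomial.eval_mul, Polynomial.eval_C, Polynomial.eval_pow, Polynomial.eval_sub,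
    Polynomial.eval_X, norm_mul, norm_pow, norm_real, Real.norm_of_nonneg hD0]
  rcases le_total T |s.im| with hs | hs
  · have hsK : ‖s‖ ≤ K * ‖s - ((A - 1 : ℝ) : ℂ)‖ := by
      have h2 := norm_le_norm_sub_add s ((A - 1 : ℝ) : ℂ)
      nlinarith [norm_nonneg ((A - 1 : ℝ) : ℂ)]
    calc ‖f s‖ ≤ C * (‖s‖ ^ N * ‖g s‖) := by simpa using hT s hA hB hs
      _ ≤ C * ((K * ‖s - ((A - 1 : ℝ) : ℂ)‖) ^ N * ‖g s‖) := by gcongr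
      _ = C * K ^ N * ‖s - ((A - 1 : ℝ) : ℂ)‖ ^ N * ‖g s‖ := by ring
      _ ≤ _ := by gcongr; exact le_max_right _ _
  · have h2 := hM s ⟨⟨hA, hB⟩, abs_le.mp hs⟩
    rw [norm_div, div_le_iff₀ (norm_pos_iff.mpr (hg0 s hA hB))] at h2
    refine h2.trans ?_
    gcongr
    exact (le_max_left _ _).trans (le_mul_of_one_le_right hD0 (one_le_pow₀ h1))

end PolynomialGrowth

/-- Lemma 3.1 (lem:gamma:poly) at a real place: if `P₁(s)·d_{−t,α}(−s)` and
`P₂(s)·a_{t,α}(s)` extend to holomorphic nowhere-vanishing functions `f₁, f₂` on the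
vertical strip `V_{A,B}`, then `f₁/f₂` is bounded by a polynomial on `V_{A,B}`. -/
theorem gammaFactor_quotient_poly_bound (n : ℕ) (hn : 1 ≤ n) (t : ℝ) (α : ℕ)
    (hα : α = 0 ∨ α = 1) (A B : ℝ) (hAB : A ≤ B) (P₁ P₂ : Polynomial ℂ) (f₁ f₂ : ℂ → ℂ)
    (hf₁ : ∀ s : ℂ, A ≤ s.re → s.re ≤ B → AnalyticAt ℂ f₁ s)
    (hf₁ne : ∀ s : ℂ, A ≤ s.re → s.re ≤ B → f₁ s ≠ 0)
    (hf₁eq : ∀ s : ℂ, A ≤ s.re → s.re ≤ B → dFun n (-t) α (-s) ≠ 0 →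
      f₁ s = P₁.eval s * dFun n (-t) α (-s))
    (hf₂ : ∀ s : ℂ, A ≤ s.re → s.re ≤ B → AnalyticAt ℂ f₂ s)
    (hf₂ne : ∀ s : ℂ, A ≤ s.re → s.re ≤ B → f₂ s ≠ 0)
    (hf₂eq : ∀ s : ℂ, A ≤ s.re → s.re ≤ B → aFun n t α s ≠ 0 →
      f₂ s = P₂.eval s * aFun n t α s) :
    ∃ Q : Polynomial ℂ, ∀ s : ℂ, A ≤ s.re → s.re ≤ B → ‖f₁ s‖ ≤ ‖Q.eval s‖ * ‖f₂ s‖ := by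
  have hP₂ : P₂ ≠ 0 := by
    rintro rfl
    refine hf₂ne ⟨A, 1 - t⟩ le_rfl hAB ?_
    rw [hf₂eq _ le_rfl hAB (aFun_ne_zero (by simp)), Polynomial.eval_zero, zero_mul]
  have hlarge : ∀ s : ℂ, |t| + 1 ≤ |s.im| → s.im + t ≠ 0 := fun s hs h0 => by
    rw [eq_neg_of_add_eq_zero_left h0, abs_neg] at hs
    linarith
  have hbound : PolyBounded A B f₁ f₂ := by
    obtain ⟨N, hN⟩ := (PolyBounded.polynomial_eval P₁ hP₂).mul
      (polyBounded_dFun_aFun (A := A) (B := B) n t α)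
    refine ⟨N, hN.congr' (eventually_stripEnds_iff.mpr ⟨|t| + 1, fun s hA hB hs => ?_⟩)
      (eventually_stripEnds_iff.mpr ⟨|t| + 1, fun s hA hB hs => ?_⟩)⟩
    · refine (hf₁eq s hA hB (dFun_ne_zero fun h => hlarge s hs ?_)).symm
      rw [neg_im] at h
      linarith
    · dsimp only
      rw [hf₂eq s hA hB (aFun_ne_zero (hlarge s hs))]
  exact hbound.exists_polynomial (fun s hA hB => (hf₁ s hA hB).continuousAt)
    (fun s hA hB => (hf₂ s hA hB).continuousAt) hf₂ne
end
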